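/- Let α ∈ (0,1), and let {t_j}_{j=0}^M be a temporal mesh on [0,T] that is quasi-graded with parameter r ≥ 1 and constants c_0 ≤ C_0. Let {t'_k}_{k=0}^{M'} be any temporal mesh on [0,T] obtained by adding new nodes to {t_j} (i.e. {t_j}_{j=0}^M ⊆ {t'_k}_{k=0}^{M'}) with the first mesh interval unchanged (t'_1 = t_1). Let u ∈ C([0,T]) ∩ C^2((0,T]) and define, relative to the mesh {t'_k}, the quantities ψ'^1 := sup_{s∈(0,t'_1)} s^{1−α} |(u(t'_1)−u(0))/(t'_1−t'_0) − u′(s)|, ψ'^l := (t'_l)^{2−α} sup_{s∈(t'_{l−1},t'_l)} |u″(s)| for l ≥ 2, and the truncation error r'^k := δ'^α_t u(t'_k) − D_t^α u(t'_k), where δ'^α_t is the L1 discrete fractional-derivative operator associated with {t'_k} applied to the sequence (u(t'_0),...,u(t'_{M'})). Then there exists a constant C > 0, depending only on α, r, T, c_0, C_0, such that |r'^k| ≤ C (τ/t'_k)^{min{α+1, (2−α)/r}} · max_{l=1,...,k} ψ'^l for all k = 1,...,M', where τ := t_1. -/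

import Mathlib

open Real MeasureTheory Set

/-- The L1 discrete fractional-derivative operator associated with the mesh `t`,
applied to the sequence `V`, at time level `m`. -/
noncomputable def deltaL1 (α : ℝ) (t : ℕ → ℝ) (V : ℕ → ℝ) (m : ℕ) : ℝ :=
  (1 / Real.Gamma (1 - α)) *
    ∑ j ∈ Finset.Icc 1 m,
      ((V j - V (j - 1)) / (t j - t (j - 1))) *
        ∫ s in (t (j - 1))..(t j), (t m - s) ^ (-α)

/-- `t 0 = 0 < t 1 < ... < t M = T` with `M ≥ 2`. -/
def IsMesh (T : ℝ) (M : ℕ) (t : ℕ → ℝ) : Prop :=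
  2 ≤ M ∧ t 0 = 0 ∧ (∀ j, j < M → t j < t (j + 1)) ∧ t M = T

/-- Quasi-graded mesh with parameter `r` and constants `c0 ≤ C0`. -/
def QuasiGraded (r c0 C0 : ℝ) (M : ℕ) (t : ℕ → ℝ) : Prop :=
  (c0 * (M : ℝ) ^ (-r) ≤ t 1 ∧ t 1 ≤ C0 * (M : ℝ) ^ (-r)) ∧
  (∀ j : ℕ, 1 ≤ j → j ≤ M →
    c0 * (t 1 * (j : ℝ) ^ r) ≤ t j ∧ t j ≤ C0 * (t 1 * (j : ℝ) ^ r)) ∧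
  (∀ j : ℕ, 1 ≤ j → j ≤ M →
    c0 * ((t 1) ^ (1 / r) * (t j) ^ (1 - 1 / r)) ≤ t j - t (j - 1) ∧
    t j - t (j - 1) ≤ C0 * ((t 1) ^ (1 / r) * (t j) ^ (1 - 1 / r)))

/-- The stability majorant `𝒱^j`. -/
noncomputable def Vcal (α γ τ tj : ℝ) : ℝ :=
  if 0 < γ then τ * tj ^ (α - 1)
  else if γ = 0 then τ * tj ^ (α - 1) * (1 + Real.log (tj / τ))
  else τ * tj ^ (α - 1) * (τ / tj) ^ γ

/-- The Caputo fractional derivative of order `α`. -/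
noncomputable def caputo (α : ℝ) (u : ℝ → ℝ) (t : ℝ) : ℝ :=
  (1 / Real.Gamma (1 - α)) * ∫ s in (0:ℝ)..t, (t - s) ^ (-α) * deriv u s

/-- The quantities `ψ'^l` relative to a mesh `t'`:
`ψ'^1 = sup_{s∈(0,t'_1)} s^{1-α} |(u(t'_1)-u(0))/(t'_1 - t'_0) - u'(s)|` and
`ψ'^l = (t'_l)^{2-α} sup_{s∈(t'_{l-1},t'_l)} |u''(s)|` for `l ≥ 2`. -/
noncomputable def psiL1 (α : ℝ) (t : ℕ → ℝ) (u : ℝ → ℝ) (j : ℕ) : ℝ :=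
  if j = 1 then
    sSup ((fun s => s ^ (1 - α) *
      |(u (t 1) - u (t 0)) / (t 1 - t 0) - deriv u s|) '' Set.Ioo 0 (t 1))
  else (t j) ^ (2 - α) *
    sSup ((fun s => |deriv (deriv u) s|) '' Set.Ioo (t (j - 1)) (t j))

lemma rpow_neg_sub_le {α y d : ℝ} (hα0 : 0 < α) (hα1 : α < 1) (hy : 0 < y) (hd : 0 ≤ d) :
    |y ^ (-α) - (y + d) ^ (-α)| ≤ d * y ^ (-α - 1) := by
  have hyd : 0 < y + d := by linarith
  have h1 : (y + d) ^ (-α) ≤ y ^ (-α) :=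
    Real.rpow_le_rpow_of_nonpos hy (by linarith) (by linarith)
  rw [abs_of_nonneg (by linarith)]
  have hq0 : 0 < y / (y + d) := by positivity
  have hq1 : y / (y + d) ≤ 1 := (div_le_one hyd).2 (by linarith)
  have h2 : y / (y + d) ≤ (y / (y + d)) ^ α := by
    simpa using Real.rpow_le_rpow_of_exponent_ge hq0 hq1 hα1.le
  have h3 : (y + d) ^ (-α) = y ^ (-α) * (y / (y + d)) ^ α := by
    rw [Real.div_rpow hy.le hyd.le, Real.rpow_neg hy.le, Real.rpow_neg hyd.le]
    field_simp
  have h4 : y ^ (-α - 1) = y ^ (-α) / y := by rw [Real.rpow_sub hy, Real.rpow_one]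
  have h5 : 1 - y / (y + d) ≤ d / y := by
    rw [one_sub_div hyd.ne', add_sub_cancel_left]
    exact div_le_div_of_nonneg_left hd hy (by linarith)
  calc y ^ (-α) - (y + d) ^ (-α) = y ^ (-α) * (1 - (y / (y + d)) ^ α) := by rw [h3]; ring
    _ ≤ y ^ (-α) * (d / y) := by gcongr; linarith
    _ = d * y ^ (-α - 1) := by rw [h4]; ring

lemma rpow_neg_mul_rpow_le {α s t : ℝ} (hα0 : 0 < α) (hα1 : α < 1) (hs : 0 < s) (hst : s < t) :
    (t - s) ^ (-α) * s ^ (α - 1) ≤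
      (t / 2) ^ (-α) * s ^ (α - 1) + (t / 2) ^ (α - 1) * (t - s) ^ (-α) := by
  have h1 : 0 < t - s := by linarith
  have ht : 0 < t := by linarith
  rcases le_total s (t / 2) with h | h
  · have : (t - s) ^ (-α) ≤ (t / 2) ^ (-α) :=
      Real.rpow_le_rpow_of_nonpos (by positivity) (by linarith) (by linarith)
    have h2 : (t - s) ^ (-α) * s ^ (α - 1) ≤ (t / 2) ^ (-α) * s ^ (α - 1) := by gcongr
    have : 0 ≤ (t / 2) ^ (α - 1) * (t - s) ^ (-α) := by positivity
    linarith
  · have : s ^ (α - 1) ≤ (t / 2) ^ (α - 1) :=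
      Real.rpow_le_rpow_of_nonpos (by positivity) (by linarith) (by linarith)
    have h2 : (t - s) ^ (-α) * s ^ (α - 1) ≤ (t - s) ^ (-α) * (t / 2) ^ (α - 1) := by gcongr
    have : 0 ≤ (t / 2) ^ (-α) * s ^ (α - 1) := by positivity
    linarith

lemma intervalIntegrable_sub_rpow {β : ℝ} (hβ : -1 < β) (t a b : ℝ) :
    IntervalIntegrable (fun s => (t - s) ^ β) volume a b := by
  simpa using (intervalIntegral.intervalIntegrable_rpow' (a := t - a) (b := t - b) hβ).comp_sub_left t

lemma intervalIntegrable_betaMajorant {α : ℝ} (hα0 : 0 < α) (hα1 : α < 1) (t a b : ℝ) :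
    IntervalIntegrable (fun s => (t / 2) ^ (-α) * s ^ (α - 1) + (t / 2) ^ (α - 1) * (t - s) ^ (-α))
      volume a b :=
  ((intervalIntegral.intervalIntegrable_rpow' (by linarith)).const_mul _).add
    ((intervalIntegrable_sub_rpow (by linarith) t a b).const_mul _)

lemma integral_betaMajorant_le {α t : ℝ} (hα0 : 0 < α) (hα1 : α < 1) (ht : 0 < t) :
    ∫ s in (0:ℝ)..t, ((t / 2) ^ (-α) * s ^ (α - 1) + (t / 2) ^ (α - 1) * (t - s) ^ (-α)) ≤
      2 / α + 2 / (1 - α) := by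
  have h1α : 0 < 1 - α := by linarith
  rw [intervalIntegral.integral_add
    ((intervalIntegral.intervalIntegrable_rpow' (by linarith)).const_mul _)
    ((intervalIntegrable_sub_rpow (by linarith) t _ _).const_mul _),
    intervalIntegral.integral_const_mul, intervalIntegral.integral_const_mul,
    intervalIntegral.integral_comp_sub_left (fun y => y ^ (-α)) t,
    integral_rpow (Or.inl (by linarith)), integral_rpow (Or.inl (by linarith))]
  simp only [sub_self, sub_zero, sub_add_cancel]
  rw [Real.zero_rpow hα0.ne', Real.zero_rpow (by linarith : -α + 1 ≠ 0),
    Real.div_rpow ht.le (by norm_num), Real.div_rpow ht.le (by norm_num)]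
  have e1 : t ^ (-α) * t ^ α = 1 := by rw [← Real.rpow_add ht]; simp
  have e2 : t ^ (α - 1) * t ^ (-α + 1) = 1 := by rw [← Real.rpow_add ht]; simp
  have b1 : ((2:ℝ) ^ (-α))⁻¹ ≤ 2 := by
    rw [← Real.rpow_neg (by norm_num), neg_neg]
    simpa using Real.rpow_le_rpow_of_exponent_le (by norm_num : (1:ℝ) ≤ 2) hα1.le
  have b2 : ((2:ℝ) ^ (α - 1))⁻¹ ≤ 2 := by
    rw [← Real.rpow_neg (by norm_num)]
    simpa using Real.rpow_le_rpow_of_exponent_le (by norm_num : (1:ℝ) ≤ 2)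
      (by linarith : -(α - 1) ≤ 1)
  calc t ^ (-α) / 2 ^ (-α) * ((t ^ α - 0) / α) +
      t ^ (α - 1) / 2 ^ (α - 1) * ((t ^ (-α + 1) - 0) / (-α + 1))
      = (t ^ (-α) * t ^ α) * (2 ^ (-α))⁻¹ / α
        + (t ^ (α - 1) * t ^ (-α + 1)) * (2 ^ (α - 1))⁻¹ / (1 - α) := by
        rw [show -α + 1 = 1 - α by ring]; ring
    _ ≤ 2 / α + 2 / (1 - α) := by
        rw [e1, e2, one_mul, one_mul]; gcongr

lemma intervalIntegrable_cutoffKernel {α H : ℝ} (hα1 : α < 1) (hH : 0 < H) {t a : ℝ}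
    (hat : a ≤ t) :
    IntervalIntegrable (fun s => (t - s) ^ (-α) * min 1 (H / (t - s))) volume a t := by
  refine (intervalIntegrable_sub_rpow (β := -α) (by linarith) t a t).mono_fun'
    (Measurable.aestronglyMeasurable (by fun_prop)) ?_
  rw [uIoc_of_le hat]
  filter_upwards [ae_restrict_mem measurableSet_Ioc] with s hs
  have h1 : 0 ≤ t - s := by linarith [hs.2]
  have h2 : 0 ≤ min 1 (H / (t - s)) := le_min zero_le_one (by positivity)
  rw [Real.norm_of_nonneg (by positivity)]
  exact mul_le_of_le_one_right (by positivity) (min_le_left _ _)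

lemma integral_cutoffKernel_le {α H : ℝ} (hα0 : 0 < α) (hα1 : α < 1) (hH : 0 < H) {t a : ℝ}
    (hat : a ≤ t - H) :
    ∫ s in a..t, (t - s) ^ (-α) * min 1 (H / (t - s)) ≤
      H ^ (1 - α) * (1 / (1 - α) + 1 / α) := by
  have h1α : 0 < 1 - α := by linarith
  have hint := intervalIntegrable_cutoffKernel hα1 hH (by linarith : a ≤ t)
  have i1 : IntervalIntegrable (fun s => (t - s) ^ (-α) * min 1 (H / (t - s))) volume a (t - H) :=
    hint.mono_set (by
      rw [uIcc_of_le hat, uIcc_of_le (by linarith)]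
      exact Icc_subset_Icc_right (by linarith))
  have i2 : IntervalIntegrable (fun s => (t - s) ^ (-α) * min 1 (H / (t - s))) volume (t - H) t :=
    hint.mono_set (by
      rw [uIcc_of_le (by linarith), uIcc_of_le (by linarith)]
      exact Icc_subset_Icc_left hat)
  rw [← intervalIntegral.integral_add_adjacent_intervals i1 i2]
  have j1 : IntervalIntegrable (fun s => H * (t - s) ^ (-α - 1)) volume a (t - H) := by
    refine IntervalIntegrable.const_mul ?_ _
    have := (intervalIntegral.intervalIntegrable_rpow (μ := volume) (a := t - a) (b := H)
      (r := -α - 1) (Or.inr ?_)).comp_sub_left t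
    · simpa using this
    · rw [uIcc_of_ge (by linarith)]; exact fun h => absurd h.1 (by linarith)
  have b1 : ∫ s in a..(t - H), (t - s) ^ (-α) * min 1 (H / (t - s)) ≤ H ^ (1 - α) / α := by
    calc _ ≤ ∫ s in a..(t - H), H * (t - s) ^ (-α - 1) := by
          refine intervalIntegral.integral_mono_on_of_le_Ioo hat i1 j1 fun s hs => ?_
          have : 0 < t - s := by linarith [hs.2]
          rw [Real.rpow_sub this, Real.rpow_one]
          calc _ ≤ (t - s) ^ (-α) * (H / (t - s)) := by gcongr; exact min_le_right _ _
            _ = _ := by ring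
      _ = H * ((H ^ (-α) - (t - a) ^ (-α)) / α) := by
          rw [intervalIntegral.integral_const_mul,
            intervalIntegral.integral_comp_sub_left (fun y => y ^ (-α - 1)) t,
            integral_rpow (Or.inr ⟨by linarith, by
              rw [uIcc_of_le (by linarith)]; exact fun h => absurd h.1 (by linarith)⟩)]
          simp only [sub_sub_cancel, sub_add_cancel]
          field_simp
          ring
      _ ≤ H * (H ^ (-α) / α) := by
          have : 0 ≤ (t - a) ^ (-α) := Real.rpow_nonneg (by linarith) _
          gcongr; linarith
      _ = H ^ (1 - α) / α := by
          rw [sub_eq_add_neg, Real.rpow_add hH, Real.rpow_one]; ring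
  have b2 : ∫ s in (t - H)..t, (t - s) ^ (-α) * min 1 (H / (t - s)) ≤ H ^ (1 - α) / (1 - α) := by
    calc _ ≤ ∫ s in (t - H)..t, (t - s) ^ (-α) := by
          refine intervalIntegral.integral_mono_on_of_le_Ioo (by linarith) i2
            (intervalIntegrable_sub_rpow (by linarith) _ _ _) fun s hs => ?_
          have : 0 < t - s := by linarith [hs.2]
          exact mul_le_of_le_one_right (by positivity) (min_le_left _ _)
      _ = H ^ (1 - α) / (1 - α) := by
          rw [intervalIntegral.integral_comp_sub_left (fun y => y ^ (-α)) t,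
            integral_rpow (Or.inl (by linarith))]
          simp only [sub_self, sub_sub_cancel]
          rw [Real.zero_rpow (by linarith : -α + 1 ≠ 0), neg_add_eq_sub, sub_zero]
  calc _ ≤ H ^ (1 - α) / α + H ^ (1 - α) / (1 - α) := add_le_add b1 b2
    _ = _ := by ring

lemma abs_intervalIntegral_le {f g : ℝ → ℝ} {a b : ℝ} (hab : a ≤ b)
    (hg : IntervalIntegrable g volume a b) (h : ∀ s ∈ Ioo a b, |f s| ≤ g s) :
    |∫ s in a..b, f s| ≤ ∫ s in a..b, g s := by
  rw [← Real.norm_eq_abs]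
  refine intervalIntegral.norm_integral_le_of_norm_le hab ?_ hg
  rw [← ae_restrict_iff' measurableSet_Ioc, ← restrict_Ioo_eq_restrict_Ioc]
  filter_upwards [ae_restrict_mem measurableSet_Ioo] with s hs using h s hs

lemma intervalIntegrable_of_abs_le_Ioo {f g : ℝ → ℝ} {a b : ℝ} (hab : a ≤ b) (hf : Measurable f)
    (hg : IntervalIntegrable g volume a b) (h : ∀ s ∈ Ioo a b, |f s| ≤ g s) :
    IntervalIntegrable f volume a b := by
  refine hg.mono_fun' hf.aestronglyMeasurable ?_
  rw [uIoc_of_le hab, ← restrict_Ioo_eq_restrict_Ioc]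
  filter_upwards [ae_restrict_mem measurableSet_Ioo] with s hs using h s hs

lemma abs_sum_Ico_le_integral {t : ℕ → ℝ} {I : ℕ → ℝ} {G : ℝ → ℝ} {m n : ℕ} (hmn : m ≤ n)
    (hG : ∀ i ∈ Ico m n, IntervalIntegrable G volume (t i) (t (i + 1)))
    (hI : ∀ i ∈ Ico m n, |I i| ≤ ∫ s in (t i)..(t (i + 1)), G s) :
    |∑ i ∈ Finset.Ico m n, I i| ≤ ∫ s in (t m)..(t n), G s := by
  rw [← intervalIntegral.sum_integral_adjacent_intervals_Ico hmn hG]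
  exact (Finset.abs_sum_le_sum_abs _ _).trans
    (Finset.sum_le_sum fun i hi => hI i (by simpa using hi))

lemma half_rpow_neg_le {β T : ℝ} (hT : 0 < T) (hβ : β ≤ 2) :
    (T / 2) ^ (-β) ≤ 4 * T ^ (-β) := by
  rw [Real.div_rpow hT.le (by norm_num), div_eq_mul_inv, ← Real.rpow_neg (by norm_num), neg_neg,
    mul_comm]
  have : (2:ℝ) ^ β ≤ 4 := by
    calc (2:ℝ) ^ β ≤ 2 ^ (2:ℝ) := Real.rpow_le_rpow_of_exponent_le (by norm_num) hβ
      _ = 4 := by norm_num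
  gcongr

lemma abs_rpow_kernel_mul_le {α a s T B e : ℝ} (hα0 : 0 < α) (hα1 : α < 1)
    (hsT : s < T) (has : a ≤ s) (he : |e| ≤ B) :
    |((T - s) ^ (-α) - (T - a) ^ (-α)) * e| ≤ (s - a) * (T - s) ^ (-α - 1) * B := by
  have := rpow_neg_sub_le hα0 hα1 (sub_pos.2 hsT) (sub_nonneg.2 has)
  rw [show T - s + (s - a) = T - a by ring] at this
  rw [abs_mul]
  gcongr

lemma integral_kernel_mul_eq {α a b T c : ℝ} {e : ℝ → ℝ}
    (he : IntervalIntegrable e volume a b)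
    (hKe : IntervalIntegrable (fun s => (T - s) ^ (-α) * e s) volume a b)
    (h0 : ∫ s in a..b, e s = 0) :
    ∫ s in a..b, (T - s) ^ (-α) * e s = ∫ s in a..b, ((T - s) ^ (-α) - c) * e s := by
  simp only [sub_mul]
  rw [intervalIntegral.integral_sub hKe (he.const_mul c), intervalIntegral.integral_const_mul, h0]
  simp

lemma abs_integral_kernel_first_le {α τ T Ψ : ℝ} {e : ℝ → ℝ} (hα0 : 0 < α) (hα1 : α < 1)
    (hτ : 0 < τ) (hτT : τ ≤ T / 2) (hΨ : 0 ≤ Ψ)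
    (he : IntervalIntegrable e volume 0 τ)
    (hKe : IntervalIntegrable (fun s => (T - s) ^ (-α) * e s) volume 0 τ)
    (h0 : ∫ s in (0:ℝ)..τ, e s = 0) (hb : ∀ s ∈ Ioo 0 τ, |e s| ≤ Ψ * s ^ (α - 1)) :
    |∫ s in (0:ℝ)..τ, (T - s) ^ (-α) * e s| ≤ 4 * (τ / T) ^ (α + 1) * Ψ := by
  have hT : 0 < T := by linarith
  rw [integral_kernel_mul_eq (c := (T - 0) ^ (-α)) he hKe h0]
  calc _ ≤ ∫ s in (0:ℝ)..τ, (T / 2) ^ (-(α + 1)) * τ ^ α * Ψ := by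
        refine abs_intervalIntegral_le hτ.le (by simp) fun s hs => ?_
        have hs0 := hs.1
        refine (abs_rpow_kernel_mul_le hα0 hα1 (by linarith [hs.2]) hs0.le (hb s hs)).trans ?_
        have h1 : (T - s) ^ (-α - 1) ≤ (T / 2) ^ (-(α + 1)) := by
          rw [show -α - 1 = -(α + 1) by ring]
          exact Real.rpow_le_rpow_of_nonpos (by positivity) (by linarith [hs.2]) (by linarith)
        have h2 : s * s ^ (α - 1) ≤ τ ^ α := by
          rw [Real.rpow_sub_one hs0.ne', mul_div_cancel₀ _ hs0.ne']
          exact Real.rpow_le_rpow hs0.le hs.2.le hα0.le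
        calc (s - 0) * (T - s) ^ (-α - 1) * (Ψ * s ^ (α - 1))
            = (T - s) ^ (-α - 1) * (s * s ^ (α - 1)) * Ψ := by ring
          _ ≤ _ := by gcongr
    _ = (T / 2) ^ (-(α + 1)) * τ ^ (α + 1) * Ψ := by
        rw [intervalIntegral.integral_const, Real.rpow_add_one hτ.ne']
        simp only [sub_zero, smul_eq_mul]; ring
    _ ≤ (4 * T ^ (-(α + 1))) * τ ^ (α + 1) * Ψ := by
        gcongr; exact half_rpow_neg_le hT (by linarith)
    _ = 4 * (τ / T) ^ (α + 1) * Ψ := by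
        rw [Real.div_rpow hτ.le hT.le, Real.rpow_neg hT.le]; ring

/-- Pointwise majorant of the truncation-error integrand away from the first mesh interval. -/
noncomputable def truncMajorant (α κ q τ H T s : ℝ) : ℝ :=
  κ ^ 2 * (T / 2) ^ (-(α + 1)) * τ ^ q * s ^ (α - q) +
    2 * H * (T / 2) ^ (-(2 - α)) * ((T - s) ^ (-α) * min 1 (H / (T - s)))

lemma intervalIntegrable_truncMajorant {α κ q τ H T a b : ℝ} (hα1 : α < 1)
    (hH : 0 < H) (ha : 0 < a) (hab : a ≤ b) (hbT : b ≤ T) :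
    IntervalIntegrable (truncMajorant α κ q τ H T) volume a b := by
  refine (IntervalIntegrable.const_mul ?_ _).add (IntervalIntegrable.const_mul ?_ _)
  · refine intervalIntegral.intervalIntegrable_rpow (Or.inr ?_)
    rw [uIcc_of_le hab]
    exact fun h => absurd h.1 (by linarith)
  · refine (intervalIntegrable_cutoffKernel hα1 hH (hab.trans hbT)).mono_set ?_
    rw [uIcc_of_le hab, uIcc_of_le (hab.trans hbT)]
    exact Icc_subset_Icc_right hbT

lemma sq_rpow_one_div {x r : ℝ} (hx : 0 ≤ x) : (x ^ (1 / r)) ^ 2 = x ^ (2 / r) := by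
  rw [← Real.rpow_natCast, ← Real.rpow_mul hx]
  congr 1
  push_cast
  ring

lemma sq_width_mul_kernel_le {α r κ q τ T Ψ s : ℝ} (hα0 : 0 < α)
    (hτ : 0 < τ) (hτs : τ ≤ s) (hsT : s ≤ T / 2) (hΨ : 0 ≤ Ψ) (hq : q ≤ 2 / r) :
    (κ * (τ ^ (1 / r) * s ^ (1 - 1 / r))) * (T - s) ^ (-α - 1) *
      ((κ * (τ ^ (1 / r) * s ^ (1 - 1 / r))) * s ^ (α - 2) * Ψ) ≤
      Ψ * (κ ^ 2 * (T / 2) ^ (-(α + 1)) * τ ^ q * s ^ (α - q)) := by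
  have hs : 0 < s := by linarith
  have hT : 0 < T := by linarith
  have h1 : (T - s) ^ (-α - 1) ≤ (T / 2) ^ (-(α + 1)) := by
    rw [show -α - 1 = -(α + 1) by ring]
    exact Real.rpow_le_rpow_of_nonpos (by linarith) (by linarith) (by linarith)
  have h2 : (τ / s) ^ (2 / r) ≤ (τ / s) ^ q :=
    Real.rpow_le_rpow_of_exponent_ge (by positivity) ((div_le_one hs).2 hτs) hq
  have h3 : (τ ^ (1 / r) * s ^ (1 - 1 / r)) ^ 2 * s ^ (α - 2) = (τ / s) ^ (2 / r) * s ^ α := by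
    rw [mul_pow, sq_rpow_one_div hτ.le, Real.div_rpow hτ.le hs.le, Real.rpow_sub hs, Real.rpow_one,
      div_pow, sq_rpow_one_div hs.le, Real.rpow_sub hs, Real.rpow_two]
    field_simp
  have h4 : τ ^ q * s ^ (α - q) = (τ / s) ^ q * s ^ α := by
    rw [Real.div_rpow hτ.le hs.le, Real.rpow_sub hs]; ring
  calc _ = Ψ * (κ ^ 2 * (T - s) ^ (-α - 1) *
        ((τ ^ (1 / r) * s ^ (1 - 1 / r)) ^ 2 * s ^ (α - 2))) := by ring
    _ ≤ Ψ * (κ ^ 2 * (T / 2) ^ (-(α + 1)) * (τ ^ q * s ^ (α - q))) := by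
        rw [h3, h4]; gcongr
    _ = _ := by ring

lemma rpow_sub_two_le_half_rpow {α s T : ℝ} (hα1 : α < 1) (hT : 0 < T) (hs : T / 2 ≤ s) :
    s ^ (α - 2) ≤ (T / 2) ^ (-(2 - α)) := by
  rw [neg_sub]
  exact Real.rpow_le_rpow_of_nonpos (by positivity) hs (by linarith)

lemma abs_integral_kernel_later_le {α r κ q τ T Ψ a b : ℝ} {e : ℝ → ℝ}
    (hα0 : 0 < α) (hα1 : α < 1) (hr1 : 1 ≤ r) (hκ : 0 < κ) (hτ : 0 < τ) (hτa : τ ≤ a)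
    (hab : a < b) (hbT : b ≤ T) (hΨ : 0 ≤ Ψ) (hq : q ≤ 2 / r)
    (hH : κ * (τ ^ (1 / r) * T ^ (1 - 1 / r)) < T / 4)
    (he : IntervalIntegrable e volume a b)
    (hKe : IntervalIntegrable (fun s => (T - s) ^ (-α) * e s) volume a b)
    (h0 : ∫ s in a..b, e s = 0) (hb : ∀ s ∈ Ioo a b, |e s| ≤ (b - a) * s ^ (α - 2) * Ψ)
    (hw : ∀ s ∈ Ioo a b, b - a ≤ κ * (τ ^ (1 / r) * s ^ (1 - 1 / r))) :
    |∫ s in a..b, (T - s) ^ (-α) * e s| ≤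
      ∫ s in a..b, Ψ * truncMajorant α κ q τ (κ * (τ ^ (1 / r) * T ^ (1 - 1 / r))) T s := by
  have ha : 0 < a := by linarith
  have hT : 0 < T := by linarith
  set H := κ * (τ ^ (1 / r) * T ^ (1 - 1 / r)) with hHdef
  have hH0 : 0 < H := by positivity
  have hr : 0 ≤ 1 - 1 / r := by
    rw [sub_nonneg, div_le_one (by linarith)]; exact hr1
  have hmono : ∀ s ∈ Ioo a b, κ * (τ ^ (1 / r) * s ^ (1 - 1 / r)) ≤ H := fun s hs => by
    have : s ^ (1 - 1 / r) ≤ T ^ (1 - 1 / r) :=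
      Real.rpow_le_rpow (by linarith [hs.1]) (by linarith [hs.2]) hr
    rw [hHdef]; gcongr
  have hbaH : b - a ≤ H := by
    have hm : (a + b) / 2 ∈ Ioo a b := ⟨by linarith, by linarith⟩
    exact (hw _ hm).trans (hmono _ hm)
  have hint := (intervalIntegrable_truncMajorant (α := α) (κ := κ) (q := q) (τ := τ) hα1 hH0 ha
    hab.le hbT).const_mul Ψ
  have hnear0 : ∀ s ∈ Ioo a b, 0 ≤ 2 * H * (T / 2) ^ (-(2 - α)) *
      ((T - s) ^ (-α) * min 1 (H / (T - s))) := fun s hs => by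
    have h1 : 0 < T - s := by linarith [hs.2]
    have : 0 ≤ min 1 (H / (T - s)) := le_min zero_le_one (by positivity)
    positivity
  have hfar0 : ∀ s ∈ Ioo a b, 0 ≤ κ ^ 2 * (T / 2) ^ (-(α + 1)) * τ ^ q * s ^ (α - q) :=
    fun s hs => by
      have h1 : 0 < s := by linarith [hs.1]
      positivity
  rcases le_or_gt b (T - H) with hfar | hnear
  · rw [integral_kernel_mul_eq (c := (T - a) ^ (-α)) he hKe h0]
    refine abs_intervalIntegral_le hab.le hint fun s hs => ?_
    have hs0 : 0 < s := by linarith [hs.1]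
    have hTs : 0 < T - s := by linarith [hs.2]
    have hba : 0 ≤ b - a := by linarith
    refine (abs_rpow_kernel_mul_le hα0 hα1 (by linarith) hs.1.le (hb s hs)).trans ?_
    rw [truncMajorant]
    rcases le_total s (T / 2) with h | h
    · calc _ ≤ (κ * (τ ^ (1 / r) * s ^ (1 - 1 / r))) * (T - s) ^ (-α - 1) *
            ((κ * (τ ^ (1 / r) * s ^ (1 - 1 / r))) * s ^ (α - 2) * Ψ) := by
            have := hw s hs
            have h2 : s - a ≤ κ * (τ ^ (1 / r) * s ^ (1 - 1 / r)) := by linarith [hs.2]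
            gcongr
        _ ≤ Ψ * (κ ^ 2 * (T / 2) ^ (-(α + 1)) * τ ^ q * s ^ (α - q)) :=
            sq_width_mul_kernel_le hα0 hτ (by linarith [hs.1]) h hΨ hq
        _ ≤ _ := by
            gcongr
            linarith [hnear0 s hs]
    · have hHTs : H / (T - s) ≤ 1 := (div_le_one hTs).2 (by linarith [hs.2])
      calc _ ≤ H * (T - s) ^ (-α - 1) * (H * (T / 2) ^ (-(2 - α)) * Ψ) := by
            have h2 : s - a ≤ H := by linarith [hs.2]
            have := rpow_sub_two_le_half_rpow hα1 hT h
            gcongr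
        _ = Ψ * (H * (T / 2) ^ (-(2 - α)) * ((T - s) ^ (-α) * min 1 (H / (T - s)))) := by
            rw [min_eq_right hHTs, Real.rpow_sub_one hTs.ne']; ring
        _ ≤ _ := by
            gcongr
            linarith [hnear0 s hs, hfar0 s hs]
  · refine abs_intervalIntegral_le hab.le hint fun s hs => ?_
    have hs0 : 0 < s := by linarith [hs.1]
    have hTs : 0 < T - s := by linarith [hs.2]
    have h : T / 2 ≤ s := by linarith [hs.1]
    have hmin : 1 / 2 ≤ min 1 (H / (T - s)) := by
      refine le_min (by norm_num) ?_
      rw [div_le_div_iff₀ (by norm_num) hTs]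
      linarith [hs.1]
    rw [abs_mul, abs_of_nonneg (by positivity), truncMajorant]
    calc _ ≤ (T - s) ^ (-α) * (H * (T / 2) ^ (-(2 - α)) * Ψ) := by
          have := rpow_sub_two_le_half_rpow hα1 hT h
          have := (hb s hs)
          refine mul_le_mul_of_nonneg_left (this.trans ?_) (by positivity)
          gcongr
      _ = Ψ * (2 * H * (T / 2) ^ (-(2 - α)) * ((T - s) ^ (-α) * (1 / 2))) := by ring
      _ ≤ Ψ * (2 * H * (T / 2) ^ (-(2 - α)) * ((T - s) ^ (-α) * min 1 (H / (T - s)))) := by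
          gcongr
      _ ≤ _ := by
          gcongr
          linarith [hfar0 s hs]

lemma exists_rpow_integral_bound {α r : ℝ} (hα0 : 0 < α) (hα1 : α < 1) (hr1 : 1 ≤ r) :
    ∃ q D : ℝ, 0 < D ∧ q ≤ 2 / r ∧ ∀ τ T : ℝ, 0 < τ → τ ≤ T →
      T ^ (-(α + 1)) * τ ^ q * ∫ s in τ..T, s ^ (α - q) ≤
        D * (τ / T) ^ min (α + 1) ((2 - α) / r) := by
  have hr : 0 < r := by linarith
  have hlt : (2 - α) / r < 2 / r := by gcongr; linarith
  have key : ∀ q τ T : ℝ, q ≠ α + 1 → 0 < τ → τ ≤ T →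
      ∫ s in τ..T, s ^ (α - q) = (T ^ (α + 1 - q) - τ ^ (α + 1 - q)) / (α + 1 - q) := by
    intro q τ T hq hτ hτT
    rw [integral_rpow (Or.inr ⟨fun h => hq (by linarith), by
      rw [uIcc_of_le hτT]; exact fun h => absurd h.1 (by linarith)⟩),
      show α - q + 1 = α + 1 - q by ring]
  rcases lt_or_ge (α + 1) (2 / r) with h | h
  · have hpos : 0 < 2 / r - (α + 1) := by linarith
    refine ⟨2 / r, 1 / (2 / r - (α + 1)), by positivity, le_rfl, fun τ T hτ hτT => ?_⟩
    have hT : 0 < T := by linarith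
    rw [key _ _ _ h.ne' hτ hτT]
    calc _ = T ^ (-(α + 1)) * τ ^ (2 / r) *
          ((τ ^ (α + 1 - 2 / r) - T ^ (α + 1 - 2 / r)) / (2 / r - (α + 1))) := by
          rw [← neg_sub (2 / r), div_neg, ← neg_div, neg_sub]
      _ ≤ T ^ (-(α + 1)) * τ ^ (2 / r) * (τ ^ (α + 1 - 2 / r) / (2 / r - (α + 1))) := by
          have : 0 ≤ T ^ (α + 1 - 2 / r) := by positivity
          gcongr
          linarith
      _ = 1 / (2 / r - (α + 1)) * (τ / T) ^ (α + 1) := by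
          rw [Real.div_rpow hτ.le hT.le, Real.rpow_neg hT.le, Real.rpow_sub hτ]
          field_simp
      _ ≤ _ := by
          gcongr ?_ * ?_
          exact Real.rpow_le_rpow_of_exponent_ge (by positivity) ((div_le_one hT).2 hτT)
            (min_le_left _ _)
  · have hq : (2 - α) / r < α + 1 := by linarith
    have hpos : 0 < α + 1 - (2 - α) / r := by linarith
    refine ⟨(2 - α) / r, 1 / (α + 1 - (2 - α) / r), by positivity, hlt.le, fun τ T hτ hτT => ?_⟩
    have hT : 0 < T := by linarith
    rw [key _ _ _ hq.ne hτ hτT, min_eq_right hq.le]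
    calc _ ≤ T ^ (-(α + 1)) * τ ^ ((2 - α) / r) *
          (T ^ (α + 1 - (2 - α) / r) / (α + 1 - (2 - α) / r)) := by
          have : 0 ≤ τ ^ (α + 1 - (2 - α) / r) := by positivity
          gcongr
          linarith
      _ = _ := by
          rw [Real.div_rpow hτ.le hT.le, Real.rpow_neg hT.le, Real.rpow_sub hT]
          field_simp

lemma intervalIntegrable_of_le_rpow {α a b T B : ℝ} {e : ℝ → ℝ} (hα0 : 0 < α) (hα1 : α < 1)
    (ha : 0 ≤ a) (hab : a ≤ b) (hbT : b ≤ T) (hm : Measurable e)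
    (hb : ∀ s ∈ Ioo a b, |e s| ≤ B * s ^ (α - 1)) :
    IntervalIntegrable e volume a b ∧
      IntervalIntegrable (fun s => (T - s) ^ (-α) * e s) volume a b ∧
      |∫ s in a..b, (T - s) ^ (-α) * e s| ≤ ∫ s in a..b,
        B * ((T / 2) ^ (-α) * s ^ (α - 1) + (T / 2) ^ (α - 1) * (T - s) ^ (-α)) := by
  have hg := (intervalIntegrable_betaMajorant hα0 hα1 T a b).const_mul B
  have hKe : ∀ s ∈ Ioo a b, |(T - s) ^ (-α) * e s| ≤
      B * ((T / 2) ^ (-α) * s ^ (α - 1) + (T / 2) ^ (α - 1) * (T - s) ^ (-α)) := fun s hs => by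
    have hs0 : 0 < s := by linarith [hs.1]
    have hTs : 0 < T - s := by linarith [hs.2]
    have hB : 0 ≤ B := by
      by_contra! h
      exact absurd ((abs_nonneg _).trans (hb s hs))
        (not_le.2 (mul_neg_of_neg_of_pos h (by positivity)))
    rw [abs_mul, abs_of_nonneg (by positivity)]
    calc _ ≤ (T - s) ^ (-α) * (B * s ^ (α - 1)) := by gcongr; exact hb s hs
      _ = B * ((T - s) ^ (-α) * s ^ (α - 1)) := by ring
      _ ≤ _ := by
          gcongr
          exact rpow_neg_mul_rpow_le hα0 hα1 hs0 (by linarith)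
  exact ⟨intervalIntegrable_of_abs_le_Ioo hab hm
      ((intervalIntegral.intervalIntegrable_rpow' (by linarith)).const_mul B) hb,
    intervalIntegrable_of_abs_le_Ioo hab (by fun_prop) hg hKe,
    abs_intervalIntegral_le hab hg hKe⟩

lemma graded_width_le {r τ s : ℝ} (hr1 : 1 ≤ r) (hτ : 0 < τ) (hτs : τ ≤ s) :
    τ ^ (1 / r) * s ^ (1 - 1 / r) ≤ s := by
  have hs : 0 < s := by linarith
  calc _ ≤ s ^ (1 / r) * s ^ (1 - 1 / r) := by gcongr
    _ = s := by rw [← Real.rpow_add hs]; simp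

lemma abs_le_rpow_of_width {α r κ τ a b s e Ψ : ℝ} (hr1 : 1 ≤ r) (hκ : 0 < κ) (hτ : 0 < τ)
    (hτs : τ ≤ s) (hΨ : 0 ≤ Ψ) (he : |e| ≤ (b - a) * s ^ (α - 2) * Ψ)
    (hw : b - a ≤ κ * (τ ^ (1 / r) * s ^ (1 - 1 / r))) :
    |e| ≤ κ * Ψ * s ^ (α - 1) := by
  have hs : 0 < s := by linarith
  have h : b - a ≤ κ * s := hw.trans (by gcongr; exact graded_width_le hr1 hτ hτs)
  calc |e| ≤ (b - a) * s ^ (α - 2) * Ψ := he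
    _ ≤ (κ * s) * s ^ (α - 2) * Ψ := by gcongr
    _ = κ * Ψ * s ^ (α - 1) := by
        rw [show α - 1 = α - 2 + 1 by ring, Real.rpow_add_one hs.ne']; ring

lemma integral_truncMajorant_le {α r κ q D τ T : ℝ} (hα0 : 0 < α) (hα1 : α < 1)
    (hκ : 0 < κ) (hτ : 0 < τ) (hτT : τ ≤ T / 2)
    (hH : κ * (τ ^ (1 / r) * T ^ (1 - 1 / r)) < T / 4)
    (hD : T ^ (-(α + 1)) * τ ^ q * ∫ s in τ..T, s ^ (α - q) ≤
      D * (τ / T) ^ min (α + 1) ((2 - α) / r)) :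
    ∫ s in τ..T, truncMajorant α κ q τ (κ * (τ ^ (1 / r) * T ^ (1 - 1 / r))) T s ≤
      (4 * κ ^ 2 * D + 8 * κ ^ (2 - α) * (1 / (1 - α) + 1 / α)) *
        (τ / T) ^ min (α + 1) ((2 - α) / r) := by
  have hT : 0 < T := by linarith
  have h1α : 0 < 1 - α := by linarith
  set H := κ * (τ ^ (1 / r) * T ^ (1 - 1 / r)) with hHdef
  have hH0 : 0 < H := by positivity
  have i1 : IntervalIntegrable (fun s : ℝ => s ^ (α - q)) volume τ T := by
    refine intervalIntegral.intervalIntegrable_rpow (Or.inr ?_)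
    rw [uIcc_of_le (by linarith)]
    exact fun h => absurd h.1 (by linarith)
  have i2 := intervalIntegrable_cutoffKernel (α := α) hα1 hH0 (by linarith : τ ≤ T)
  have hHT : H / T = κ * (τ / T) ^ (1 / r) := by
    rw [hHdef, Real.div_rpow hτ.le hT.le, Real.rpow_sub hT, Real.rpow_one]
    field_simp
  have hcut := integral_cutoffKernel_le (a := τ) (t := T) hα0 hα1 hH0 (by linarith)
  have hint0 : 0 ≤ ∫ s in τ..T, s ^ (α - q) :=
    intervalIntegral.integral_nonneg (by linarith)
      fun s hs => Real.rpow_nonneg (by linarith [hs.1]) _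
  have hcut0 : 0 ≤ ∫ s in τ..T, (T - s) ^ (-α) * min 1 (H / (T - s)) :=
    intervalIntegral.integral_nonneg (by linarith) fun s hs => by
      have h1 : 0 ≤ T - s := by linarith [hs.2]
      have : 0 ≤ min 1 (H / (T - s)) := le_min zero_le_one (by positivity)
      positivity
  simp only [truncMajorant]
  rw [intervalIntegral.integral_add (i1.const_mul _) (i2.const_mul _),
    intervalIntegral.integral_const_mul, intervalIntegral.integral_const_mul, add_mul]
  refine add_le_add ?_ ?_
  · calc _ ≤ κ ^ 2 * (4 * T ^ (-(α + 1))) * τ ^ q * ∫ s in τ..T, s ^ (α - q) := by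
          gcongr; exact half_rpow_neg_le hT (by linarith)
      _ = 4 * κ ^ 2 * (T ^ (-(α + 1)) * τ ^ q * ∫ s in τ..T, s ^ (α - q)) := by ring
      _ ≤ 4 * κ ^ 2 * (D * (τ / T) ^ min (α + 1) ((2 - α) / r)) := by gcongr
      _ = _ := by ring
  · calc _ ≤ 2 * H * (4 * T ^ (-(2 - α))) * (H ^ (1 - α) * (1 / (1 - α) + 1 / α)) := by
          have := half_rpow_neg_le (β := 2 - α) hT (by linarith)
          gcongr
      _ = 8 * (H / T) ^ (2 - α) * (1 / (1 - α) + 1 / α) := by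
          rw [Real.div_rpow hH0.le hT.le, Real.rpow_neg hT.le,
            show 2 - α = 1 - α + 1 by ring, Real.rpow_add_one hH0.ne']
          ring
      _ = 8 * κ ^ (2 - α) * (1 / (1 - α) + 1 / α) * (τ / T) ^ ((2 - α) / r) := by
          rw [hHT, Real.mul_rpow hκ.le (by positivity), ← Real.rpow_mul (by positivity),
            show 1 / r * (2 - α) = (2 - α) / r by ring]
          ring
      _ ≤ _ := by
          gcongr ?_ * ?_
          exact Real.rpow_le_rpow_of_exponent_ge (by positivity)
            ((div_le_one hT).2 (by linarith)) (min_le_right _ _)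

lemma one_le_mul_rpow_of_width_large {α r κ τ T : ℝ} (hα0 : 0 < α) (hr1 : 1 ≤ r) (hκ : 0 < κ)
    (hτ : 0 < τ) (hτT : τ ≤ T) (hH : T / 4 ≤ κ * (τ ^ (1 / r) * T ^ (1 - 1 / r))) :
    1 ≤ (4 * κ) ^ 2 * (τ / T) ^ min (α + 1) ((2 - α) / r) := by
  have hT : 0 < T := by linarith
  have h1 : 1 ≤ 4 * κ * (τ / T) ^ (1 / r) := by
    rw [Real.rpow_sub hT, Real.rpow_one] at hH
    rw [Real.div_rpow hτ.le hT.le]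
    rw [show κ * (τ ^ (1 / r) * (T / T ^ (1 / r))) = κ * (τ ^ (1 / r) / T ^ (1 / r)) * T by ring]
      at hH
    nlinarith
  have h2 : (τ / T) ^ (2 / r) ≤ (τ / T) ^ min (α + 1) ((2 - α) / r) := by
    refine Real.rpow_le_rpow_of_exponent_ge (by positivity) ((div_le_one hT).2 hτT)
      ((min_le_right _ _).trans ?_)
    have : 0 < r := by linarith
    gcongr
    linarith
  calc (1:ℝ) ≤ (4 * κ * (τ / T) ^ (1 / r)) ^ 2 := one_le_pow₀ h1
    _ = (4 * κ) ^ 2 * (τ / T) ^ (2 / r) := by rw [mul_pow, sq_rpow_one_div (by positivity)]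
    _ ≤ _ := by gcongr

theorem exists_kernel_sum_bound {α r κ : ℝ} (hα0 : 0 < α) (hα1 : α < 1) (hr1 : 1 ≤ r)
    (hκ : 1 ≤ κ) :
    ∃ C : ℝ, 0 < C ∧ ∀ (t : ℕ → ℝ) (n : ℕ) (e : ℕ → ℝ → ℝ) (Ψ : ℝ), 1 ≤ n → t 0 = 0 →
      (∀ i j, i < j → j ≤ n → t i < t j) → 0 ≤ Ψ → (∀ i, Measurable (e i)) →
      (∀ i < n, ∫ s in (t i)..(t (i + 1)), e i s = 0) →
      (∀ s ∈ Ioo 0 (t 1), |e 0 s| ≤ Ψ * s ^ (α - 1)) →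
      (∀ i, 1 ≤ i → i < n → ∀ s ∈ Ioo (t i) (t (i + 1)),
        |e i s| ≤ (t (i + 1) - t i) * s ^ (α - 2) * Ψ ∧
        t (i + 1) - t i ≤ κ * ((t 1) ^ (1 / r) * s ^ (1 - 1 / r))) →
      |∑ i ∈ Finset.Ico 0 n, ∫ s in (t i)..(t (i + 1)), (t n - s) ^ (-α) * e i s| ≤
        C * (t 1 / t n) ^ min (α + 1) ((2 - α) / r) * Ψ := by
  obtain ⟨q, D, hD0, hq, hD⟩ := exists_rpow_integral_bound hα0 hα1 hr1
  have h1α : 0 < 1 - α := by linarith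
  have hκ0 : 0 < κ := by linarith
  refine ⟨κ * (2 / α + 2 / (1 - α)) * (4 * κ) ^ 2 +
    (4 + (4 * κ ^ 2 * D + 8 * κ ^ (2 - α) * (1 / (1 - α) + 1 / α))), by positivity, ?_⟩
  intro t n e Ψ hn ht0 hmono hΨ hm hzero hfirst hlater
  set T := t n
  set τ := t 1
  have hτ : 0 < τ := ht0 ▸ hmono 0 1 one_pos hn
  have hle : ∀ i j, i ≤ j → j ≤ n → t i ≤ t j := fun i j hij hj => by
    rcases hij.eq_or_lt with rfl | h
    exacts [le_rfl, (hmono i j h hj).le]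
  have hτT : τ ≤ T := hle 1 n hn le_rfl
  have hT : 0 < T := by linarith
  set p := min (α + 1) ((2 - α) / r)
  have hx : 0 ≤ (τ / T) ^ p := by positivity
  have hunif : ∀ i < n, ∀ s ∈ Ioo (t i) (t (i + 1)), |e i s| ≤ κ * Ψ * s ^ (α - 1) := by
    intro i hi s hs
    rcases Nat.eq_zero_or_pos i with rfl | hi0
    · rw [ht0] at hs
      have hs0 : 0 < s := hs.1
      refine (hfirst s hs).trans ?_
      gcongr
      nlinarith
    · obtain ⟨h1, h2⟩ := hlater i hi0 hi s hs
      exact abs_le_rpow_of_width hr1 hκ0 hτ ((hle 1 i hi0 hi.le).trans hs.1.le) hΨ h1 h2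
  have hI : ∀ i < n, _ := fun i hi =>
    intervalIntegrable_of_le_rpow (T := T) hα0 hα1 (ht0 ▸ hle 0 i i.zero_le hi.le)
      (hle i (i + 1) i.le_succ hi) (hle (i + 1) n hi le_rfl) (hm i) (hunif i hi)
  rcases le_or_gt (T / 4) (κ * (τ ^ (1 / r) * T ^ (1 - 1 / r))) with hH | hH
  · have h1 := one_le_mul_rpow_of_width_large hα0 hr1 hκ0 hτ hτT hH
    have h2 := abs_sum_Ico_le_integral (t := t) (Nat.zero_le n)
      (fun i _ => (intervalIntegrable_betaMajorant hα0 hα1 T (t i) (t (i + 1))).const_mul (κ * Ψ))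
      (fun i hi => (hI i hi.2).2.2)
    rw [intervalIntegral.integral_const_mul, ht0] at h2
    refine h2.trans ?_
    calc _ ≤ κ * Ψ * (2 / α + 2 / (1 - α)) := by
          gcongr; exact integral_betaMajorant_le hα0 hα1 hT
      _ ≤ κ * Ψ * (2 / α + 2 / (1 - α)) * ((4 * κ) ^ 2 * (τ / T) ^ p) :=
          le_mul_of_one_le_right (by positivity) h1
      _ = κ * (2 / α + 2 / (1 - α)) * (4 * κ) ^ 2 * (τ / T) ^ p * Ψ := by ring
      _ ≤ _ := by
          gcongr
          exact le_add_of_nonneg_right (by positivity)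
  · have hτ2 : τ ≤ T / 2 := by
      have h1 : τ ≤ τ ^ (1 / r) * T ^ (1 - 1 / r) := by
        have hr : 0 ≤ 1 - 1 / r := by
          rw [sub_nonneg, div_le_one (by linarith)]; exact hr1
        calc τ = τ ^ (1 / r) * τ ^ (1 - 1 / r) := by rw [← Real.rpow_add hτ]; simp
          _ ≤ _ := by gcongr
      nlinarith
    have hH0 : 0 < κ * (τ ^ (1 / r) * T ^ (1 - 1 / r)) := by positivity
    have hA := abs_integral_kernel_first_le (e := e 0) (T := T) hα0 hα1 hτ hτ2 hΨ
      (by simpa [ht0] using (hI 0 hn).1) (by simpa [ht0] using (hI 0 hn).2.1)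
      (by simpa [ht0] using hzero 0 hn) hfirst
    have hB := abs_sum_Ico_le_integral (t := t) (m := 1) (n := n) hn
      (fun i hi => (intervalIntegrable_truncMajorant (α := α) (κ := κ) (q := q) (τ := τ) (T := T)
        hα1 hH0 (hτ.trans_le (hle 1 i hi.1 hi.2.le)) (hle i (i + 1) i.le_succ hi.2)
        (hle (i + 1) n hi.2 le_rfl)).const_mul Ψ)
      (fun i hi => abs_integral_kernel_later_le hα0 hα1 hr1 hκ0 hτ (hle 1 i hi.1 hi.2.le)
        (hmono i (i + 1) i.lt_succ_self hi.2) (hle (i + 1) n hi.2 le_rfl) hΨ hq hH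
        (hI i hi.2).1 (hI i hi.2).2.1 (hzero i hi.2)
        (fun s hs => (hlater i hi.1 hi.2 s hs).1) (fun s hs => (hlater i hi.1 hi.2 s hs).2))
    rw [intervalIntegral.integral_const_mul] at hB
    have hG := integral_truncMajorant_le hα0 hα1 hκ0 hτ hτ2 hH (hD τ T hτ hτT)
    rw [Finset.sum_eq_sum_Ico_succ_bot (Nat.pos_of_ne_zero (by omega))]
    refine (abs_add_le _ _).trans ?_
    have hxα : (τ / T) ^ (α + 1) ≤ (τ / T) ^ p :=
      Real.rpow_le_rpow_of_exponent_ge (by positivity) ((div_le_one hT).2 hτT) (min_le_left _ _)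
    rw [ht0]
    calc _ ≤ 4 * (τ / T) ^ (α + 1) * Ψ +
          Ψ * ((4 * κ ^ 2 * D + 8 * κ ^ (2 - α) * (1 / (1 - α) + 1 / α)) * (τ / T) ^ p) := by
          refine add_le_add hA (hB.trans ?_)
          gcongr
      _ ≤ 4 * (τ / T) ^ p * Ψ +
          Ψ * ((4 * κ ^ 2 * D + 8 * κ ^ (2 - α) * (1 / (1 - α) + 1 / α)) * (τ / T) ^ p) := by
          gcongr
      _ = (4 + (4 * κ ^ 2 * D + 8 * κ ^ (2 - α) * (1 / (1 - α) + 1 / α))) * (τ / T) ^ p * Ψ := by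
          ring
      _ ≤ _ := by
          refine mul_le_mul_of_nonneg_right (mul_le_mul_of_nonneg_right
            (le_add_of_nonneg_left ?_) hx) hΨ
          positivity

lemma differentiableAt_and_deriv_of_contDiffOn {u : ℝ → ℝ} {T s : ℝ}
    (hu : ContDiffOn ℝ 2 u (Ioc 0 T)) (hs : s ∈ Ioo 0 T) :
    DifferentiableAt ℝ u s ∧ DifferentiableAt ℝ (deriv u) s := by
  have h : ContDiffOn ℝ (1 + 1) u (Ioo 0 T) := by
    have := hu.mono Ioo_subset_Ioc_self
    norm_num
    exact this
  rw [contDiffOn_succ_iff_deriv_of_isOpen isOpen_Ioo] at h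
  have hn : Ioo 0 T ∈ nhds s := isOpen_Ioo.mem_nhds hs
  exact ⟨(h.1 s hs).differentiableAt hn,
    (h.2.2.differentiableOn one_ne_zero s hs).differentiableAt hn⟩

lemma abs_slope_sub_deriv_le {u : ℝ → ℝ} {a b S s : ℝ} (hab : a < b)
    (hc : ContinuousOn u (Icc a b)) (hd : ∀ x ∈ Ioo a b, DifferentiableAt ℝ u x)
    (hd2 : ∀ x ∈ Ioo a b, DifferentiableAt ℝ (deriv u) x)
    (hS : ∀ x ∈ Ioo a b, |deriv (deriv u) x| ≤ S) (hs : s ∈ Ioo a b) :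
    |(u b - u a) / (b - a) - deriv u s| ≤ (b - a) * S := by
  obtain ⟨ξ, hξ, h⟩ := exists_deriv_eq_slope u hab hc
    fun x hx => (hd x hx).differentiableWithinAt
  rw [← h]
  have h1 := (convex_Ioo a b).norm_image_sub_le_of_norm_deriv_le hd2 hS hs hξ
  have h2 : |ξ - s| ≤ b - a := abs_le.2 ⟨by linarith [hξ.1, hs.2], by linarith [hξ.2, hs.1]⟩
  have hS0 : 0 ≤ S := (abs_nonneg _).trans (hS s hs)
  calc |deriv u ξ - deriv u s| ≤ S * |ξ - s| := h1
    _ ≤ S * (b - a) := by gcongr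
    _ = (b - a) * S := mul_comm _ _

lemma integral_slope_sub_deriv {u : ℝ → ℝ} {a b : ℝ} (hab : a < b)
    (hc : ContinuousOn u (Icc a b)) (hd : ∀ x ∈ Ioo a b, DifferentiableAt ℝ u x)
    (hi : IntervalIntegrable (fun s => (u b - u a) / (b - a) - deriv u s) volume a b) :
    ∫ s in a..b, ((u b - u a) / (b - a) - deriv u s) = 0 := by
  have hi' : IntervalIntegrable (deriv u) volume a b := by
    simpa using (intervalIntegrable_const (c := (u b - u a) / (b - a))).sub hi
  rw [intervalIntegral.integral_sub intervalIntegrable_const hi',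
    intervalIntegral.integral_eq_sub_of_hasDerivAt_of_le hab.le hc
      (fun x hx => (hd x hx).hasDerivAt) hi', intervalIntegral.integral_const, smul_eq_mul,
    mul_div_cancel₀ _ (by linarith : b - a ≠ 0), sub_self]

lemma deltaL1_sub_caputo_eq {α : ℝ} {t : ℕ → ℝ} {u : ℝ → ℝ} {k : ℕ} (hα1 : α < 1)
    (ht0 : t 0 = 0)
    (hi : ∀ i < k, IntervalIntegrable (fun s => (t k - s) ^ (-α) *
      ((u (t (i + 1)) - u (t i)) / (t (i + 1) - t i) - deriv u s)) volume (t i) (t (i + 1))) :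
    deltaL1 α t (fun l => u (t l)) k - caputo α u (t k) =
      (1 / Real.Gamma (1 - α)) * ∑ i ∈ Finset.Ico 0 k, ∫ s in (t i)..(t (i + 1)),
        (t k - s) ^ (-α) * ((u (t (i + 1)) - u (t i)) / (t (i + 1) - t i) - deriv u s) := by
  have hK : ∀ a b, IntervalIntegrable (fun s => (t k - s) ^ (-α)) volume a b :=
    intervalIntegrable_sub_rpow (by linarith) (t k)
  have hKu : ∀ i ∈ Ico 0 k, IntervalIntegrable (fun s => (t k - s) ^ (-α) * deriv u s)
      volume (t i) (t (i + 1)) := fun i hik => by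
    have := ((hK (t i) (t (i + 1))).mul_const
      ((u (t (i + 1)) - u (t i)) / (t (i + 1) - t i))).sub (hi i hik.2)
    refine this.congr fun s _ => ?_
    ring
  rw [deltaL1, caputo, ← mul_sub]
  congr 1
  rw [← ht0, ← intervalIntegral.sum_integral_adjacent_intervals_Ico k.zero_le hKu]
  have hshift : ∀ f : ℕ → ℝ, ∑ j ∈ Finset.Icc 1 k, f j = ∑ i ∈ Finset.Ico 0 k, f (i + 1) :=
    fun f => by
      rw [Finset.sum_Ico_add' f 0 k 1]
      rfl
  rw [hshift, ← Finset.sum_sub_distrib]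
  refine Finset.sum_congr rfl fun i hik => ?_
  simp only [add_tsub_cancel_right, mul_sub]
  rw [intervalIntegral.integral_sub ((hK _ _).mul_const _) (hKu i (by simpa using hik)),
    intervalIntegral.integral_mul_const, mul_comm]

lemma IsMesh.lt {T : ℝ} {M : ℕ} {t : ℕ → ℝ} (h : IsMesh T M t) {i j : ℕ} (hij : i < j)
    (hj : j ≤ M) : t i < t j := by
  induction j, hij using Nat.le_induction with
  | base => exact h.2.2.1 i hj
  | succ j hij ih => exact (ih (by omega)).trans (h.2.2.1 j hj)

lemma IsMesh.le {T : ℝ} {M : ℕ} {t : ℕ → ℝ} (h : IsMesh T M t) {i j : ℕ} (hij : i ≤ j)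
    (hj : j ≤ M) : t i ≤ t j := by
  rcases hij.eq_or_lt with rfl | h'
  exacts [le_rfl, (h.lt h' hj).le]

lemma exists_coarse_interval {T : ℝ} {M M' : ℕ} {t t' : ℕ → ℝ} (h : IsMesh T M t)
    (h' : IsMesh T M' t') (hsub : ∀ j : ℕ, j ≤ M → ∃ k : ℕ, k ≤ M' ∧ t' k = t j)
    (h1 : t' 1 = t 1) {i : ℕ} (hi1 : 1 ≤ i) (hi : i < M') :
    ∃ j, 2 ≤ j ∧ j ≤ M ∧ t (j - 1) ≤ t' i ∧ t' (i + 1) ≤ t j := by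
  classical
  have hex : ∃ j, t' (i + 1) ≤ t j := ⟨M, by rw [h.2.2.2, ← h'.2.2.2]; exact h'.le hi le_rfl⟩
  have hspec := Nat.find_spec hex
  have hmin := fun m => Nat.find_min (H := hex) (m := m)
  set j := Nat.find hex
  have hjM : j ≤ M := Nat.find_le (by rw [h.2.2.2, ← h'.2.2.2]; exact h'.le hi le_rfl)
  have hj2 : 2 ≤ j := by
    by_contra! hlt
    have h2 : t j ≤ t 1 := h.le (by omega) (by have := h.1; omega)
    have h3 := h'.lt (show 1 < i + 1 by omega) hi
    linarith
  refine ⟨j, hj2, hjM, ?_, hspec⟩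
  have hlt := not_le.1 (hmin (j - 1) (by omega))
  obtain ⟨m, hm, hmj⟩ := hsub (j - 1) (by omega)
  rw [← hmj] at hlt ⊢
  refine h'.le ?_ hi.le
  by_contra! hcon
  exact absurd (h'.le (show i + 1 ≤ m by omega) hm) (not_le.2 hlt)

lemma QuasiGraded.le_mul_pred {r c0 C0 T : ℝ} {M : ℕ} {t : ℕ → ℝ} (hr1 : 1 ≤ r) (hc0 : 0 < c0)
    (hcC : c0 ≤ C0) (h : IsMesh T M t) (hq : QuasiGraded r c0 C0 M t) {j : ℕ} (hj2 : 2 ≤ j)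
    (hj : j ≤ M) : t j ≤ C0 / c0 * 2 ^ r * t (j - 1) := by
  have hτ : 0 < t 1 := h.2.1 ▸ h.lt one_pos (by omega)
  have hC0 : 0 < C0 := by linarith
  have h1 := (hq.2.1 j (by omega) hj).2
  have h2 := (hq.2.1 (j - 1) (by omega) (by omega)).1
  have h3 : (j : ℝ) ≤ 2 * ((j - 1 : ℕ) : ℝ) := by
    have : j ≤ 2 * (j - 1) := by omega
    exact_mod_cast this
  have h4 : (j : ℝ) ^ r ≤ 2 ^ r * ((j - 1 : ℕ) : ℝ) ^ r := by
    rw [← Real.mul_rpow (by norm_num) (by positivity)]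
    exact Real.rpow_le_rpow (by positivity) h3 (by linarith)
  calc t j ≤ C0 * (t 1 * (j : ℝ) ^ r) := h1
    _ ≤ C0 * (t 1 * (2 ^ r * ((j - 1 : ℕ) : ℝ) ^ r)) := by gcongr
    _ = C0 / c0 * 2 ^ r * (c0 * (t 1 * ((j - 1 : ℕ) : ℝ) ^ r)) := by field_simp
    _ ≤ _ := by gcongr

lemma refined_width_le {r c0 C0 T : ℝ} {M M' : ℕ} {t t' : ℕ → ℝ} (hr1 : 1 ≤ r) (hc0 : 0 < c0)
    (hcC : c0 ≤ C0) (h : IsMesh T M t) (hq : QuasiGraded r c0 C0 M t) (h' : IsMesh T M' t')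
    (hsub : ∀ j : ℕ, j ≤ M → ∃ k : ℕ, k ≤ M' ∧ t' k = t j) (h1 : t' 1 = t 1) {i : ℕ}
    (hi1 : 1 ≤ i) (hi : i < M') {s : ℝ} (hs : t' i ≤ s) :
    t' (i + 1) - t' i ≤
      (1 + C0 * (C0 / c0 * 2 ^ r)) * ((t' 1) ^ (1 / r) * s ^ (1 - 1 / r)) := by
  obtain ⟨j, hj2, hjM, hja, hjb⟩ := exists_coarse_interval h h' hsub h1 hi1 hi
  have hC0 : 0 < C0 := by linarith
  have hτ : 0 < t 1 := h.2.1 ▸ h.lt one_pos (by omega)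
  have htj : 0 < t j := hτ.trans_le (h.le (by omega) hjM)
  have hs0 : 0 < s := hτ.trans_le ((h1 ▸ h'.le hi1 hi.le).trans hs)
  set K := C0 / c0 * 2 ^ r
  have hK1 : 1 ≤ K := one_le_mul_of_one_le_of_one_le ((one_le_div hc0).2 hcC)
    (Real.one_le_rpow (by norm_num) (by linarith))
  have hr : 0 ≤ 1 - 1 / r := by
    rw [sub_nonneg, div_le_one (by linarith)]; exact hr1
  have hr' : 1 - 1 / r ≤ 1 := by
    have : 0 ≤ 1 / r := by positivity
    linarith
  have hts : t j ≤ K * s := (hq.le_mul_pred hr1 hc0 hcC h hj2 hjM).trans (by gcongr; linarith)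
  rw [h1]
  calc t' (i + 1) - t' i ≤ t j - t (j - 1) := by linarith
    _ ≤ C0 * ((t 1) ^ (1 / r) * (t j) ^ (1 - 1 / r)) := (hq.2.2 j (by omega) hjM).2
    _ ≤ C0 * ((t 1) ^ (1 / r) * (K * s ^ (1 - 1 / r))) := by
        gcongr
        calc (t j) ^ (1 - 1 / r) ≤ (K * s) ^ (1 - 1 / r) := by gcongr
          _ = K ^ (1 - 1 / r) * s ^ (1 - 1 / r) := Real.mul_rpow (by linarith) hs0.le
          _ ≤ K * s ^ (1 - 1 / r) := by
              gcongr
              simpa using Real.rpow_le_rpow_of_exponent_le hK1 hr'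
    _ = (C0 * K) * ((t 1) ^ (1 / r) * s ^ (1 - 1 / r)) := by ring
    _ ≤ _ := by gcongr; linarith

lemma psiL1_nonneg_one (α : ℝ) (t : ℕ → ℝ) (u : ℝ → ℝ) : 0 ≤ psiL1 α t u 1 := by
  rw [psiL1, if_pos rfl]
  refine Real.sSup_nonneg ?_
  rintro _ ⟨s, hs, rfl⟩
  have := hs.1
  positivity

/-- Truncation-error bound for the L1 operator on a mesh obtained by adding nodes
to a quasi-graded mesh, first mesh interval unchanged (Corollary 3.4). -/
theorem stmt11 (α r T c0 C0 : ℝ)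
    (hα0 : 0 < α) (hα1 : α < 1) (hr1 : 1 ≤ r)
    (hT : 0 < T) (hc0 : 0 < c0) (hcC : c0 ≤ C0) :
    ∃ C : ℝ, 0 < C ∧
      ∀ (M : ℕ) (t : ℕ → ℝ) (M' : ℕ) (t' : ℕ → ℝ),
        IsMesh T M t → QuasiGraded r c0 C0 M t →
        IsMesh T M' t' →
        (∀ j : ℕ, j ≤ M → ∃ k : ℕ, k ≤ M' ∧ t' k = t j) →
        t' 1 = t 1 →
        ∀ u : ℝ → ℝ, ContinuousOn u (Set.Icc 0 T) → ContDiffOn ℝ 2 u (Set.Ioc 0 T) →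
          BddAbove ((fun s => s ^ (1 - α) *
            |(u (t' 1) - u (t' 0)) / (t' 1 - t' 0) - deriv u s|) '' Set.Ioo 0 (t' 1)) →
          (∀ l : ℕ, 2 ≤ l → l ≤ M' →
            BddAbove ((fun s => |deriv (deriv u) s|) '' Set.Ioo (t' (l - 1)) (t' l))) →
          ∀ (k : ℕ) (hk : 1 ≤ k), k ≤ M' →
            |deltaL1 α t' (fun l => u (t' l)) k - caputo α u (t' k)| ≤
              C * (t 1 / t' k) ^ min (α + 1) ((2 - α) / r) *
                (Finset.Icc 1 k).sup' (Finset.nonempty_Icc.mpr hk) (psiL1 α t' u) := by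
  obtain ⟨C, hC, hmain⟩ := exists_kernel_sum_bound (κ := 1 + C0 * (C0 / c0 * 2 ^ r)) hα0 hα1 hr1
    (by have : 0 < C0 := by linarith
        exact le_add_of_nonneg_right (by positivity))
  have hΓ : 0 < Real.Gamma (1 - α) := Real.Gamma_pos_of_pos (by linarith)
  refine ⟨1 / Real.Gamma (1 - α) * C, by positivity, ?_⟩
  intro M t M' t' h hq h' hsub h1 u hu hu2 hb1 hb2 k hk hkM
  set Ψ := (Finset.Icc 1 k).sup' (Finset.nonempty_Icc.mpr hk) (psiL1 α t' u)
  have hψ : ∀ l, 1 ≤ l → l ≤ k → psiL1 α t' u l ≤ Ψ := fun l hl hlk =>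
    Finset.le_sup' (psiL1 α t' u) (Finset.mem_Icc.2 ⟨hl, hlk⟩)
  have hΨ : 0 ≤ Ψ := (psiL1_nonneg_one α t' u).trans (hψ 1 le_rfl hk)
  have hC0 : 0 < C0 := by linarith
  have hκ : 0 < 1 + C0 * (C0 / c0 * 2 ^ r) := by positivity
  have ht0 : t' 0 = 0 := h'.2.1
  have hτ : 0 < t' 1 := ht0 ▸ h'.lt one_pos (hk.trans hkM)
  have hnonneg : ∀ i ≤ M', 0 ≤ t' i := fun i hi => ht0 ▸ h'.le i.zero_le hi
  have hleT : ∀ i ≤ M', t' i ≤ T := fun i hi => h'.2.2.2 ▸ h'.le hi le_rfl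
  let e : ℕ → ℝ → ℝ := fun i s =>
    (u (t' (i + 1)) - u (t' i)) / (t' (i + 1) - t' i) - deriv u s
  have hdiff : ∀ i < M', ∀ s ∈ Ioo (t' i) (t' (i + 1)),
      DifferentiableAt ℝ u s ∧ DifferentiableAt ℝ (deriv u) s := fun i hi s hs =>
    differentiableAt_and_deriv_of_contDiffOn hu2
      ⟨(hnonneg i hi.le).trans_lt hs.1, hs.2.trans_le (hleT _ hi)⟩
  have hcont : ∀ i < M', ContinuousOn u (Icc (t' i) (t' (i + 1))) := fun i hi =>
    hu.mono (Icc_subset_Icc (hnonneg i hi.le) (hleT _ hi))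
  have hm : ∀ i, Measurable (e i) := fun i => measurable_const.sub (measurable_deriv u)
  have hfirst : ∀ s ∈ Ioo 0 (t' 1), |e 0 s| ≤ Ψ * s ^ (α - 1) := fun s hs => by
    have hs0 := hs.1
    have h2 : s ^ (1 - α) * |e 0 s| ≤ Ψ := by
      refine le_trans ?_ (hψ 1 le_rfl hk)
      rw [psiL1, if_pos rfl]
      exact le_csSup hb1 ⟨s, hs, rfl⟩
    calc |e 0 s| = s ^ (1 - α) * |e 0 s| * s ^ (α - 1) := by
          rw [mul_right_comm, ← Real.rpow_add hs0]; simp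
      _ ≤ _ := by gcongr
  have hlater : ∀ i, 1 ≤ i → i < k → ∀ s ∈ Ioo (t' i) (t' (i + 1)),
      |e i s| ≤ (t' (i + 1) - t' i) * s ^ (α - 2) * Ψ ∧ t' (i + 1) - t' i ≤
        (1 + C0 * (C0 / c0 * 2 ^ r)) * ((t' 1) ^ (1 / r) * s ^ (1 - 1 / r)) := by
    intro i hi1 hik s hs
    have hi : i < M' := by omega
    refine ⟨?_, refined_width_le hr1 hc0 hcC h hq h' hsub h1 hi1 hi hs.1.le⟩
    have hab := h'.lt i.lt_succ_self hi
    have hs0 : 0 < s := (hnonneg i hi.le).trans_lt hs.1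
    have hbpos : 0 < t' (i + 1) := hs0.trans hs.2
    set S := sSup ((fun s => |deriv (deriv u) s|) '' Ioo (t' i) (t' (i + 1)))
    have hS0 : 0 ≤ S := Real.sSup_nonneg (by rintro _ ⟨x, -, rfl⟩; positivity)
    have hS : ∀ x ∈ Ioo (t' i) (t' (i + 1)), |deriv (deriv u) x| ≤ S := fun x hx =>
      le_csSup (hb2 (i + 1) (by omega) hi) ⟨x, hx, rfl⟩
    have hψS : (t' (i + 1)) ^ (2 - α) * S ≤ Ψ := by
      have := hψ (i + 1) (by omega) hik
      rwa [psiL1, if_neg (by omega)] at this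
    have hSΨ : S ≤ s ^ (α - 2) * Ψ := by
      calc S = s ^ (α - 2) * (s ^ (2 - α) * S) := by
            rw [← mul_assoc, ← Real.rpow_add hs0]; simp
        _ ≤ s ^ (α - 2) * ((t' (i + 1)) ^ (2 - α) * S) := by
            have : s ^ (2 - α) ≤ (t' (i + 1)) ^ (2 - α) :=
              Real.rpow_le_rpow hs0.le hs.2.le (by linarith)
            gcongr
        _ ≤ _ := by gcongr
    rw [mul_assoc]
    exact (abs_slope_sub_deriv_le hab (hcont i hi) (fun x hx => (hdiff i hi x hx).1)
      (fun x hx => (hdiff i hi x hx).2) hS hs).trans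
        (mul_le_mul_of_nonneg_left hSΨ (by linarith))
  have hint : ∀ i < k, IntervalIntegrable (e i) volume (t' i) (t' (i + 1)) ∧
      IntervalIntegrable (fun s => (t' k - s) ^ (-α) * e i s) volume (t' i) (t' (i + 1)) := by
    intro i hik
    have hi : i < M' := by omega
    rcases Nat.eq_zero_or_pos i with rfl | hi0
    · have := intervalIntegrable_of_le_rpow (T := t' k) hα0 hα1 le_rfl hτ.le (h'.le hk hkM) (hm 0)
        hfirst
      rw [ht0]
      exact ⟨this.1, this.2.1⟩
    · have := intervalIntegrable_of_le_rpow (T := t' k)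
        (B := (1 + C0 * (C0 / c0 * 2 ^ r)) * Ψ) hα0 hα1 (hnonneg i hi.le)
        (h'.le i.le_succ hi) (h'.le hik hkM) (hm i) fun s hs =>
          abs_le_rpow_of_width hr1 hκ hτ ((h'.le hi0 hi.le).trans hs.1.le) hΨ
            (hlater i hi0 hik s hs).1 (hlater i hi0 hik s hs).2
      exact ⟨this.1, this.2.1⟩
  have hzero : ∀ i < k, ∫ s in (t' i)..(t' (i + 1)), e i s = 0 := fun i hik =>
    integral_slope_sub_deriv (h'.lt i.lt_succ_self (by omega)) (hcont i (by omega))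
      (fun x hx => (hdiff i (by omega) x hx).1) (hint i hik).1
  have hfinal := hmain t' k e Ψ hk ht0 (fun i j hij hj => h'.lt hij (hj.trans hkM)) hΨ hm hzero
    hfirst hlater
  rw [deltaL1_sub_caputo_eq hα1 ht0 fun i hik => (hint i hik).2, abs_mul,
    abs_of_pos (by positivity), ← h1, mul_assoc, mul_assoc]
  gcongr
  rw [← mul_assoc]
  exact hfinal
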